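/- arXiv:2101.00247 — 2 statements merged into one kernel-verified Lean document; each statement's English description precedes it below -/
import Mathlib

section
/- Let G be a finite group and σ a partition of the set of all primes. Suppose that for every prime p dividing |G|, every Sylow p-subgroup P of G, and every maximal subgroup V of P, there exists a subgroup T of G with VT = G such that T is σ-soluble. Then G is σ-soluble. -/
open scoped Pointwise

/-- `σ` is a partition of the set of all primes: each class is nonempty, the
classes are pairwise disjoint, and their union is the set of all primes. -/
def SigmaPartition {ι : Type*} (σ : ι → Set ℕ) : Prop :=
  (∀ i, (σ i).Nonempty) ∧ (Pairwise fun i j => Disjoint (σ i) (σ j)) ∧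
    (⋃ i, σ i) = {p : ℕ | p.Prime}

/-- A group is `σ`-primary if all primes dividing its order lie in a single class `σ i`. -/
def SigmaPrimary {ι : Type*} (σ : ι → Set ℕ) (G : Type*) [Group G] : Prop :=
  ∃ i, ∀ p : ℕ, p.Prime → p ∣ Nat.card G → p ∈ σ i

/-- A group is `σ`-soluble if it has a normal series all of whose factors are
`σ`-primary (the order of the factor `c k.succ / c k.castSucc` is the index
`((c k.castSucc).subgroupOf (c k.succ)).index`). -/
def SigmaSoluble {ι : Type*} (σ : ι → Set ℕ) (G : Type*) [Group G] : Prop :=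
  ∃ (n : ℕ) (c : Fin (n + 1) → Subgroup G),
    c 0 = ⊥ ∧ c (Fin.last n) = ⊤ ∧ Monotone c ∧ (∀ k, (c k).Normal) ∧
    ∀ k : Fin n, ∃ i, ∀ p : ℕ, p.Prime →
      p ∣ ((c k.castSucc).subgroupOf (c k.succ)).index → p ∈ σ i

/-- A group is `σ`-nilpotent if it is the (internal) direct product of finitely many
`σ`-primary (normal) subgroups. -/
def SigmaNilpotent {ι : Type*} (σ : ι → Set ℕ) (G : Type*) [Group G] : Prop :=
  ∃ (n : ℕ) (H : Fin n → Subgroup G),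
    (∀ k, (H k).Normal) ∧ iSupIndep H ∧ (⨆ k, H k) = ⊤ ∧
    ∀ k, ∃ i, ∀ p : ℕ, p.Prime → p ∣ Nat.card (H k) → p ∈ σ i

/-- A Hall `ρ`-subgroup: all primes dividing its order lie in `ρ`, and no prime
dividing its index lies in `ρ`. -/
def IsHallSubgroup {G : Type*} [Group G] (ρ : Set ℕ) (H : Subgroup G) : Prop :=
  (∀ p : ℕ, p.Prime → p ∣ Nat.card H → p ∈ ρ) ∧
  (∀ p : ℕ, p.Prime → p ∣ H.index → p ∉ ρ)

/-- A Hall `σ i`-subgroup of `G`. -/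
def IsHallSigmaSubgroup {ι : Type*} (σ : ι → Set ℕ) {G : Type*} [Group G]
    (i : ι) (H : Subgroup G) : Prop :=
  IsHallSubgroup (σ i) H

/-- A complete Hall `σ`-set of `G`: every nontrivial member is a Hall
`σ i`-subgroup for some `i`, and for every `i` with `σ i ∩ π(G) ≠ ∅` the set
contains exactly one Hall `σ i`-subgroup of `G`. -/
def CompleteHallSigmaSet {ι : Type*} (σ : ι → Set ℕ) (G : Type*) [Group G]
    (ℋ : Set (Subgroup G)) : Prop :=
  (∀ H ∈ ℋ, H ≠ ⊥ → ∃ i, IsHallSigmaSubgroup σ i H) ∧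
  ∀ i, (∃ p : ℕ, p.Prime ∧ p ∈ σ i ∧ p ∣ Nat.card G) →
    ∃! H : Subgroup G, H ∈ ℋ ∧ IsHallSigmaSubgroup σ i H

/-- A subgroup `A` is `σ`-permutable in `G` if `G` has a complete Hall `σ`-set `ℋ`
with `A Hˣ = Hˣ A` for all `H ∈ ℋ` and all `x ∈ G`. -/
def SigmaPermutable {ι : Type*} (σ : ι → Set ℕ) {G : Type*} [Group G]
    (A : Subgroup G) : Prop :=
  ∃ ℋ : Set (Subgroup G), CompleteHallSigmaSet σ G ℋ ∧
    ∀ H ∈ ℋ, ∀ x : G,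
      (A : Set G) * (H.map (MulAut.conj x).toMonoidHom : Set G) =
        (H.map (MulAut.conj x).toMonoidHom : Set G) * (A : Set G)

/-- `G` is a `PσT`-group: `σ`-permutability is transitive, i.e. if `H` is
`σ`-permutable in `G` and `K` is `σ`-permutable in `H`, then `K` is
`σ`-permutable in `G`. -/
def IsPSigmaT {ι : Type*} (σ : ι → Set ℕ) (G : Type*) [Group G] : Prop :=
  ∀ H : Subgroup G, SigmaPermutable σ H →
    ∀ K : Subgroup ↥H, SigmaPermutable σ K →
      SigmaPermutable σ (K.map H.subtype)

open Polynomial in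
theorem avg_roots_of_unity (m : ℕ) (hm : 0 < m) (s : Multiset ℂ) (hs : ∀ z ∈ s, z ^ m = 1)
    (n : ℕ) (hn : 0 < n) (hcard : s.card = n) (a : ℂ) (ha : (n : ℂ) * a = s.sum)
    (hIntegral : IsIntegral ℤ a) : a = 0 ∨ ∀ z ∈ s, z = a := by
  by_cases ha0 : a = 0
  · exact Or.inl ha0
  right
  have hnC : (n : ℂ) ≠ 0 := by exact_mod_cast hn.ne'
  have hnorm : ∀ z : ℂ, z ^ m = 1 → ‖z‖ = 1 := fun z hz => Complex.norm_eq_one_of_pow_eq_one hz hm.ne'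
  let S : Set ℂ := {z | z ∈ s}
  have hfin : Finite S := Set.Finite.to_subtype (by
    have : S = (s.toFinset : Set ℂ) := by ext; simp [S]
    rw [this]; exact s.toFinset.finite_toSet)
  have hSint : ∀ x ∈ S, IsIntegral ℚ x := by
    intro x hx
    refine ⟨X ^ m - 1, by simpa using monic_X_pow_sub_C (1 : ℚ) hm.ne', ?_⟩
    simp [hs x hx]
  let K := IntermediateField.adjoin ℚ S
  have : FiniteDimensional ℚ K := IntermediateField.finiteDimensional_adjoin hSint
  have : NumberField K := ⟨⟩
  have hSK : ∀ z ∈ s, z ∈ K := fun z hz => IntermediateField.subset_adjoin ℚ S hz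
  have hsum : s.sum ∈ K := multiset_sum_mem s hSK
  have haK : a ∈ K := by
    have : a = s.sum / (n : ℂ) := by field_simp; linear_combination ha
    rw [this]
    exact div_mem hsum (natCast_mem K n)
  obtain ⟨t, ht⟩ : ∃ t : Multiset K, t.map (algebraMap K ℂ) = s := by
    refine ⟨s.attach.map fun z => ⟨z.1, hSK z.1 z.2⟩, ?_⟩
    rw [Multiset.map_map]
    conv_rhs => rw [← Multiset.attach_map_val s]
    rfl
  let aK : K := ⟨a, haK⟩
  have haK' : algebraMap K ℂ aK = a := rfl
  have hsumK : (n : K) * aK = t.sum := by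
    apply (algebraMap K ℂ).injective
    rw [map_mul, haK', map_multiset_sum, ht, map_natCast, ha]
  have htm : ∀ z ∈ t, z ^ m = 1 := by
    intro z hz
    apply (algebraMap K ℂ).injective
    rw [map_pow, map_one]
    exact hs _ (by rw [← ht]; exact Multiset.mem_map_of_mem _ hz)
  have hIntegral' : IsIntegral ℤ aK := by
    rw [← haK'] at hIntegral
    exact (isIntegral_algebraMap_iff (algebraMap K ℂ).injective).1 hIntegral
  obtain ⟨k, hk, hak⟩ := NumberField.Embeddings.pow_eq_one_of_norm_le_one K ℂ (x := aK)
    (by intro h; apply ha0; rw [← haK', h, map_zero]) hIntegral' (by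
      intro φ
      have h1 : (n : ℂ) * φ aK = (t.map φ).sum := by
        rw [← map_multiset_sum, ← hsumK, map_mul, map_natCast]
      have h2 : ‖(t.map φ).sum‖ ≤ ((t.map φ).map (fun z => ‖z‖)).sum := norm_multiset_sum_le _
      have h3 : ((t.map φ).map (fun z => ‖z‖)).sum = n := by
        rw [Multiset.map_map, Multiset.map_congr rfl (g := fun _ => (1 : ℝ))]
        · simp [← hcard, ← ht]
        · intro z hz
          apply hnorm
          rw [← map_pow, htm z hz, map_one]
      rw [← h1, h3, norm_mul, Complex.norm_natCast] at h2
      have : (0 : ℝ) < n := by exact_mod_cast hn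
      nlinarith)
  have hanorm : ‖a‖ = 1 := by
    apply Complex.norm_eq_one_of_pow_eq_one (n := k) _ hk.ne'
    rw [← haK', ← map_pow, hak, map_one]
  -- equality case
  have hconj : (starRingEnd ℂ) a * a = 1 := by
    rw [mul_comm, Complex.mul_conj, Complex.normSq_eq_norm_sq, hanorm]; simp
  have hre : ∀ z ∈ s, ((starRingEnd ℂ) a * z).re ≤ 1 := by
    intro z hz
    refine (Complex.re_le_norm _).trans ?_
    rw [norm_mul, Complex.norm_conj, hanorm, hnorm z (hs z hz)]; norm_num
  have hsumre : (s.map fun z => ((starRingEnd ℂ) a * z).re).sum = n := by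
    have h1 : (s.map fun z => ((starRingEnd ℂ) a * z)).sum = n := by
      rw [Multiset.sum_map_mul_left, Multiset.map_id', ← ha]
      linear_combination (n : ℂ) * hconj
    have h2 := congrArg Complex.reAddGroupHom h1
    rw [map_multiset_sum, Multiset.map_map] at h2
    simpa using h2
  have hall : ∀ z ∈ s, ((starRingEnd ℂ) a * z).re = 1 := by
    by_contra! h
    obtain ⟨z, hz, hne⟩ := h
    have : (s.map fun z => ((starRingEnd ℂ) a * z).re).sum < (s.map fun _ => (1 : ℝ)).sum :=
      Multiset.sum_lt_sum hre ⟨z, hz, lt_of_le_of_ne (hre z hz) hne⟩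
    rw [hsumre] at this
    simp [hcard] at this
  intro z hz
  have h1 : ‖(starRingEnd ℂ) a * z‖ = 1 := by
    rw [norm_mul, Complex.norm_conj, hanorm, hnorm z (hs z hz)]; norm_num
  have h2 : (starRingEnd ℂ) a * z = 1 := by
    have h3 := hall z hz
    have h4 : Complex.normSq ((starRingEnd ℂ) a * z) = 1 := by
      rw [Complex.normSq_eq_norm_sq, h1]; norm_num
    rw [Complex.normSq_apply, h3] at h4
    apply Complex.ext
    · simpa using h3
    · simp only [Complex.one_im]; nlinarith
  calc z = ((starRingEnd ℂ) a * a) * z := by rw [hconj, one_mul]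
    _ = a * ((starRingEnd ℂ) a * z) := by ring
    _ = a := by rw [h2, mul_one]

open Polynomial in
theorem matrix_root_pow {d : ℕ} (M : Matrix (Fin d) (Fin d) ℂ) (m : ℕ) 
    (hM : M ^ m = 1) (z : ℂ) (hz : z ∈ M.charpoly.roots) : z ^ m = 1 := by
  have h1 : z ∈ spectrum ℂ M := by
    rw [Matrix.mem_spectrum_iff_isRoot_charpoly]
    exact isRoot_of_mem_roots hz
  have h2 := spectrum.pow_mem_pow M m h1
  rw [hM] at h2
  have : Nontrivial (Matrix (Fin d) (Fin d) ℂ) := by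
    by_contra h
    rw [not_nontrivial_iff_subsingleton] at h
    simp [spectrum.of_subsingleton] at h1
  simpa [spectrum.one_eq] using h2

theorem matrix_trace_integral {d : ℕ} (M : Matrix (Fin d) (Fin d) ℂ) (m : ℕ) (hm : 0 < m)
    (hM : M ^ m = 1) : IsIntegral ℤ M.trace := by
  rw [Matrix.trace_eq_sum_roots_charpoly]
  apply IsIntegral.multiset_sum
  intro z hz
  exact IsIntegral.of_pow hm (by rw [matrix_root_pow M m hM z hz]; exact isIntegral_one)

open Polynomial in
theorem matrix_scalar_of {d : ℕ} (hd : 0 < d) (M : Matrix (Fin d) (Fin d) ℂ) (m : ℕ) (hm : 0 < m)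
    (hM : M ^ m = 1) (a : ℂ) (ha : (d : ℂ) * a = M.trace) (hIntegral : IsIntegral ℤ a) :
    a = 0 ∨ M = algebraMap ℂ _ a := by
  have hcard : M.charpoly.roots.card = d := by
    rw [← (IsAlgClosed.splits M.charpoly).natDegree_eq_card_roots, Matrix.charpoly_natDegree_eq_dim]
    simp
  rcases avg_roots_of_unity m hm M.charpoly.roots (matrix_root_pow M m hM) d hd hcard a
    (by rw [ha, Matrix.trace_eq_sum_roots_charpoly]) hIntegral with h | h
  · exact Or.inl h
  right
  have hch : M.charpoly = (X - C a) ^ d := by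
    have h1 := (IsAlgClosed.splits M.charpoly).eq_prod_roots_of_monic M.charpoly_monic
    rw [h1, Multiset.eq_replicate.2 ⟨hcard, h⟩]
    simp
  have hsq : Squarefree (X ^ m - 1 : ℂ[X]) :=
    (separable_X_pow_sub_C (1 : ℂ) (by exact_mod_cast hm.ne') one_ne_zero).squarefree
  have hmin : minpoly ℂ M ∣ X ^ m - 1 := minpoly.dvd _ _ (by simp [hM])
  have h2 : minpoly ℂ M ∣ (X - C a) := by
    rw [← (hsq.squarefree_of_dvd hmin).dvd_pow_iff_dvd hd.ne', ← hch]
    exact Matrix.minpoly_dvd_charpoly M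
  obtain ⟨r, hr⟩ := h2
  have h3 : aeval M (X - C a) = 0 := by rw [hr, map_mul, minpoly.aeval, zero_mul]
  simpa [sub_eq_zero] using h3


theorem trace_mulLeft_pi {n : ℕ} (d : Fin n → ℕ)
    (y : Π i, Matrix (Fin (d i)) (Fin (d i)) ℂ) :
    LinearMap.trace ℂ _ (LinearMap.mulLeft ℂ y) = ∑ i, (d i : ℂ) * (y i).trace := by
  classical
  let b := Pi.basis (fun i => Matrix.stdBasis ℂ (Fin (d i)) (Fin (d i)))
  rw [LinearMap.trace_eq_matrix_trace ℂ b, Matrix.trace, Fintype.sum_sigma]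
  apply Finset.sum_congr rfl
  intro i _
  rw [Fintype.sum_prod_type]
  have : ∀ x z, (LinearMap.toMatrix b b (LinearMap.mulLeft ℂ y)).diag ⟨i, x, z⟩ = y i x x := by
    intro x z
    rw [Matrix.diag_apply, LinearMap.toMatrix_apply]
    simp only [b, Pi.basis_apply, Pi.basis_repr, Matrix.stdBasis_eq_single,
      LinearMap.mulLeft_apply, Pi.mul_apply, Pi.single_eq_same]
    change (y i * (Matrix.single x z 1 : Matrix (Fin (d i)) (Fin (d i)) ℂ)) x z = _
    simp
  rw [Finset.sum_congr rfl fun x _ => Finset.sum_congr rfl fun z _ => this x z]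
  simp [Matrix.trace, Finset.mul_sum]

theorem trace_mulLeft_monoidAlgebra {G : Type*} [Group G] [Finite G] (x : MonoidAlgebra ℂ G) :
    LinearMap.trace ℂ _ (LinearMap.mulLeft ℂ x) = (Nat.card G : ℂ) * x.coeff 1 := by
  classical
  have := Fintype.ofFinite G
  let b : Module.Basis G ℂ (MonoidAlgebra ℂ G) := MonoidAlgebra.basis G ℂ
  rw [LinearMap.trace_eq_matrix_trace ℂ b, Matrix.trace]
  have : ∀ h, (LinearMap.toMatrix b b (LinearMap.mulLeft ℂ x)).diag h = x.coeff 1 := by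
    intro h
    rw [Matrix.diag_apply, LinearMap.toMatrix_apply]
    change (x * MonoidAlgebra.single h 1).coeff h = _
    simp
  rw [Finset.sum_congr rfl fun h _ => this h]
  simp

theorem matrix_central_scalar {A : Type*} [Ring A] [Algebra ℂ A] {d : ℕ}
    (f : A →ₐ[ℂ] Matrix (Fin d) (Fin d) ℂ) (hf : Function.Surjective f) (z : A)
    (hz : ∀ a, a * z = z * a) : ∃ c : ℂ, f z = algebraMap ℂ _ c := by
  have : f z ∈ Subalgebra.center ℂ (Matrix (Fin d) (Fin d) ℂ) := by
    rw [Subalgebra.mem_center_iff]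
    intro b
    obtain ⟨a, rfl⟩ := hf b
    rw [← map_mul, ← map_mul, hz]
  rw [Algebra.IsCentral.center_eq_bot, Algebra.mem_bot] at this
  obtain ⟨c, hc⟩ := this
  exact ⟨c, hc.symm⟩

open MonoidAlgebra in
theorem burnside_class {G : Type*} [Group G] [Finite G] [IsSimpleGroup G] (g : G)
    (hg : g ∉ Subgroup.center G) (p : ℕ) (hp : p.Prime) (k : ℕ)
    (hC : Nat.card (conjugatesOf g) = p ^ k) : False := by
  classical
  have := Fintype.ofFinite G
  have : NeZero (Nat.card G : ℂ) := ⟨by exact_mod_cast Nat.card_pos.ne'⟩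
  have hG0 : (Nat.card G : ℂ) ≠ 0 := this.out
  obtain ⟨n, d, hd, ⟨e⟩⟩ :=
    IsSemisimpleRing.exists_algEquiv_pi_matrix_of_isAlgClosed ℂ (MonoidAlgebra ℂ G)
  let u : G → MonoidAlgebra ℂ G := fun h => MonoidAlgebra.of ℂ G h
  let avg : MonoidAlgebra ℂ G := (Nat.card G : ℂ)⁻¹ • ∑ h, u h
  have hcentral : ∀ z : MonoidAlgebra ℂ G, (∀ h, u h * z = z * u h) → ∀ a, a * z = z * a := by
    intro z hz a
    induction a using MonoidAlgebra.induction_on with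
    | of h => exact hz h
    | add x y hx hy => rw [add_mul, mul_add, hx, hy]
    | smul r x hx => rw [smul_mul_assoc, mul_smul_comm, hx]
  have hleft : ∀ h, u h * avg = avg := by
    intro h
    simp only [avg, mul_smul_comm, Finset.mul_sum]
    congr 1
    exact Fintype.sum_equiv (Equiv.mulLeft h) _ _ (fun x => by simp [u])
  have hright : ∀ h, avg * u h = avg := by
    intro h
    simp only [avg, smul_mul_assoc, Finset.sum_mul]
    congr 1
    exact Fintype.sum_equiv (Equiv.mulRight h) _ _ (fun x => by simp [u])
  have hidem : avg * avg = avg := by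
    conv_lhs => enter [1]; simp only [avg]
    rw [smul_mul_assoc, Finset.sum_mul, Finset.sum_congr rfl fun h _ => hleft h]
    rw [Finset.sum_const, Finset.card_univ, ← Nat.card_eq_fintype_card, ← Nat.cast_smul_eq_nsmul ℂ,
      smul_smul, inv_mul_cancel₀ hG0, one_smul]
  let C : Finset G := (conjugatesOf g).toFinset
  have hCcard : C.card = p ^ k := by
    rw [← hC, Nat.card_eq_card_toFinset]
  have hmem : ∀ c, c ∈ C ↔ IsConj g c := fun c => Set.mem_toFinset
  let z : MonoidAlgebra ℂ G := ∑ c ∈ C, u c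
  have hz : ∀ h, u h * z = z * u h := by
    intro h
    simp only [z, Finset.mul_sum, Finset.sum_mul]
    refine Finset.sum_equiv (MulAut.conj h).toEquiv ?_ ?_
    · intro c
      rw [hmem, hmem]
      have : IsConj c ((MulAut.conj h).toEquiv c) := isConj_iff.2 ⟨h, rfl⟩
      exact ⟨fun h' => h'.trans this, fun h' => h'.trans this.symm⟩
    · intro c _
      simp [u]
  have hg1 : g ≠ 1 := fun h => hg (h ▸ Subgroup.one_mem _)
  -- trace identity
  have htr : ∑ i, (d i : ℂ) * (e (u g - avg) i).trace = -1 := by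
    rw [← trace_mulLeft_pi, ← LinearMap.trace_conj' (LinearMap.mulLeft ℂ (e (u g - avg)))
      e.symm.toLinearEquiv]
    have : e.symm.toLinearEquiv.conj (LinearMap.mulLeft ℂ (e (u g - avg))) =
        LinearMap.mulLeft ℂ (u g - avg) := by
      apply LinearMap.ext
      intro x
      simp [LinearEquiv.conj_apply]
    rw [this, trace_mulLeft_monoidAlgebra]
    have h1 : (u g).coeff 1 = 0 := by simp [u, hg1]
    have h2 : avg.coeff 1 = (Nat.card G : ℂ)⁻¹ := by
      simp [avg, u, Finsupp.single_apply]
    rw [MonoidAlgebra.coeff_sub, Finsupp.sub_apply, h1, h2]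
    field_simp
    simp
  have key : ∀ i, ∃ w : ℂ, IsIntegral ℤ w ∧ (d i : ℂ) * (e (u g - avg) i).trace = p * w := by
    intro i
    let ρ : MonoidAlgebra ℂ G →ₐ[ℂ] Matrix (Fin (d i)) (Fin (d i)) ℂ :=
      (Pi.evalAlgHom ℂ _ i).comp e.toAlgHom
    have hρ : ∀ x, e x i = ρ x := fun x => rfl
    have hsurj : Function.Surjective ρ :=
      (Function.surjective_eval i).comp e.surjective
    have hdi : 0 < d i := Nat.pos_of_ne_zero (hd i).out
    have : Nonempty (Fin (d i)) := ⟨⟨0, hdi⟩⟩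
    let M : G →* Matrix (Fin (d i)) (Fin (d i)) ℂ := (ρ : MonoidAlgebra ℂ G →* _).comp (MonoidAlgebra.of ℂ G)
    have hM : ∀ h, M h = ρ (u h) := fun h => rfl
    rw [hρ, map_sub]
    obtain ⟨c, hc⟩ := matrix_central_scalar ρ hsurj avg
      (hcentral avg fun h => by rw [hleft, hright])
    have hcc : c * c = c := by
      apply (algebraMap ℂ (Matrix (Fin (d i)) (Fin (d i)) ℂ)).injective
      rw [map_mul, ← hc, ← map_mul, hidem]
    have hc01 : c = 0 ∨ c = 1 := by
      rcases eq_or_ne c 0 with h | h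
      · exact Or.inl h
      · exact Or.inr (mul_left_cancel₀ h (by rw [hcc, mul_one]))
    rcases hc01 with rfl | rfl
    swap
    · refine ⟨0, isIntegral_zero, ?_⟩
      have : ρ (u g) = ρ avg := by
        rw [← hleft g, map_mul, hc, map_one, mul_one]
      simp [this]
    rw [map_zero] at hc
    rw [hc, sub_zero, ← hM]
    have hMpow : M g ^ Nat.card G = 1 := by rw [← map_pow, pow_card_eq_one', map_one]
    have htint := matrix_trace_integral (M g) _ Nat.card_pos hMpow
    by_cases hpd : p ∣ d i
    · obtain ⟨t, ht⟩ := hpd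
      refine ⟨t * (M g).trace, (IsIntegral.mul ?_ htint), ?_⟩
      · exact_mod_cast isIntegral_algebraMap (R := ℤ) (A := ℂ) (x := (t : ℤ))
      · have ht' : (d i : ℂ) = p * t := by exact_mod_cast congrArg (Nat.cast : ℕ → ℂ) ht
        linear_combination (M g).trace * ht'
    refine ⟨0, isIntegral_zero, ?_⟩
    suffices (M g).trace = 0 by simp [this]
    obtain ⟨l, hl⟩ := matrix_central_scalar ρ hsurj z (hcentral z hz)
    have hlint : IsIntegral ℤ l := by
      let ψ := MonoidAlgebra.lift ℤ (Matrix (Fin (d i)) (Fin (d i)) ℂ) G M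
      have h1 : ψ (∑ c ∈ C, MonoidAlgebra.of ℤ G c) = algebraMap ℂ _ l := by
        rw [← hl, map_sum, map_sum]
        exact Finset.sum_congr rfl fun c _ => by simp [ψ, hM]
      have : Module.Finite ℤ (MonoidAlgebra ℤ G) := Module.Finite.of_basis (MonoidAlgebra.basis G ℤ)
      have h2 : IsIntegral ℤ (∑ c ∈ C, MonoidAlgebra.of ℤ G c) := IsIntegral.of_finite ℤ _
      have h3 := h2.map ψ
      rw [h1] at h3
      exact (isIntegral_algebraMap_iff
        (algebraMap ℂ (Matrix (Fin (d i)) (Fin (d i)) ℂ)).injective).1 h3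
    have hconjtr : ∀ c ∈ C, (M c).trace = (M g).trace := by
      intro c hc
      rw [hmem] at hc
      obtain ⟨h, rfl⟩ := isConj_iff.1 hc
      rw [map_mul, Matrix.trace_mul_comm, ← map_mul]
      simp
    have hltr : (d i : ℂ) * l = p ^ k * (M g).trace := by
      have h1 := congrArg Matrix.trace hl
      rw [map_sum, Matrix.trace_sum, Finset.sum_congr rfl (f := fun c => (ρ (u c)).trace) (g := fun _ => (M g).trace) hconjtr, Finset.sum_const, hCcard,
        Matrix.algebraMap_eq_diagonal, Matrix.trace_diagonal] at h1
      simp at h1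
      rw [h1]
    have hcop : IsCoprime (d i : ℤ) ((p : ℤ) ^ k) := by
      have : Nat.Coprime (d i) (p ^ k) :=
        Nat.Coprime.pow_right k ((Nat.Prime.coprime_iff_not_dvd hp).2 hpd).symm
      exact_mod_cast Nat.isCoprime_iff_coprime.2 this
    obtain ⟨r, s, hrs⟩ := hcop
    have hrsC : (r : ℂ) * d i + s * (p : ℂ) ^ k = 1 := by exact_mod_cast congrArg (Int.cast : ℤ → ℂ) hrs
    have hIntegral : IsIntegral ℤ ((r : ℂ) * (M g).trace + s * l) :=
      ((isIntegral_algebraMap (R := ℤ) (A := ℂ) (x := r)).mul htint).add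
        ((isIntegral_algebraMap (R := ℤ) (A := ℂ) (x := s)).mul hlint)
    have hval : (d i : ℂ) * ((r : ℂ) * (M g).trace + s * l) = (M g).trace := by
      linear_combination (M g).trace * hrsC + s * hltr
    rcases matrix_scalar_of hdi (M g) _ Nat.card_pos hMpow _ hval hIntegral with h0 | h0
    · rw [← hval, h0, mul_zero]
    exfalso
    rcases M.normal_ker.eq_bot_or_eq_top with hk | hk
    · apply hg
      rw [Subgroup.mem_center_iff]
      intro h
      apply (MonoidHom.ker_eq_bot_iff M).1 hk
      rw [map_mul, map_mul, h0]
      exact (Algebra.commutes _ _).symm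
    · have h1 : ∀ h, ρ (u h) = 1 := fun h => by
        rw [← hM]; exact MonoidHom.mem_ker.1 (hk ▸ Subgroup.mem_top h)
      have h2 : ρ avg = 1 := by
        simp only [avg, map_smul, map_sum, h1]
        rw [Finset.sum_const, Finset.card_univ, ← Nat.card_eq_fintype_card,
          ← Nat.cast_smul_eq_nsmul ℂ, smul_smul, inv_mul_cancel₀ hG0, one_smul]
      rw [hc] at h2
      exact zero_ne_one h2
  choose w hw1 hw2 using key
  rw [Finset.sum_congr rfl fun i _ => hw2 i, ← Finset.mul_sum] at htr
  have hW : IsIntegral ℤ (∑ i, w i) := IsIntegral.sum _ fun i _ => hw1 i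
  have hp0 : (p : ℂ) ≠ 0 := by exact_mod_cast hp.ne_zero
  have hq : ∑ i, w i = algebraMap ℚ ℂ (-1 / p) := by
    rw [map_div₀, map_neg, map_one, map_natCast]
    field_simp
    linear_combination htr
  rw [hq] at hW
  have hW' := (isIntegral_algebraMap_iff (algebraMap ℚ ℂ).injective).1 hW
  obtain ⟨t, ht⟩ := IsIntegrallyClosed.isIntegral_iff.1 hW'
  have hpQ : (p : ℚ) ≠ 0 := by exact_mod_cast hp.ne_zero
  have h3 : (t : ℚ) * p = -1 := by
    have : (t : ℚ) = -1 / p := ht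
    rw [this]; field_simp
  have h4 : t * (p : ℤ) = -1 := by exact_mod_cast h3
  have h5 : (p : ℤ) ∣ 1 := ⟨-t, by linarith⟩
  have := Int.eq_one_of_dvd_one (by positivity) h5
  exact hp.one_lt.ne' (by exact_mod_cast this)


/-- All primes dividing the order of `H` lie in `π`. -/
def PiSub {G : Type*} [Group G] (π : Set ℕ) (H : Subgroup G) : Prop :=
  ∀ p : ℕ, p.Prime → p ∣ Nat.card H → p ∈ π

theorem PiSub.of_dvd {G H : Type*} [Group G] [Group H] {π : Set ℕ} {A : Subgroup G}
    {B : Subgroup H} (h : PiSub π A) (hd : Nat.card B ∣ Nat.card A) : PiSub π B :=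
  fun p hp hpB => h p hp (hpB.trans hd)

theorem PiSub.sup {G : Type*} [Group G] {π : Set ℕ} {A B : Subgroup G} [A.Normal]
    (hA : PiSub π A) (hB : PiSub π B) : PiSub π (A ⊔ B) := by
  intro p hp hd
  have h1 : Nat.card A * A.relIndex (A ⊔ B) = Nat.card ↥(A ⊔ B) := by
    rw [← Subgroup.relIndex_bot_left, ← Subgroup.relIndex_bot_left,
      Subgroup.relIndex_mul_relIndex _ _ _ bot_le le_sup_left]
  rw [Subgroup.relIndex_sup_left] at h1
  rw [← h1, hp.dvd_mul] at hd
  rcases hd with hd | hd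
  · exact hA p hp hd
  · exact hB p hp (hd.trans (Subgroup.relIndex_dvd_card _ _))

theorem exists_core {G : Type*} [Group G] [Finite G] (π : Set ℕ) :
    ∃ N : Subgroup G, N.Characteristic ∧ PiSub π N ∧
      ∀ M : Subgroup G, M.Normal → PiSub π M → M ≤ N := by
  obtain ⟨N, hN⟩ := (Set.toFinite {N : Subgroup G | N.Normal ∧ PiSub π N}).exists_maximal
    ⟨⊥, inferInstance, fun p hp hd => by
      rw [Subgroup.card_bot] at hd; exact absurd hd hp.not_dvd_one⟩
  obtain ⟨hNn, hNp⟩ := hN.prop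
  have hmax : ∀ M : Subgroup G, M.Normal → PiSub π M → M ≤ N := by
    intro M hM hMp
    have h1 : N ⊔ M ∈ {N : Subgroup G | N.Normal ∧ PiSub π N} := ⟨inferInstance, hNp.sup hMp⟩
    exact le_sup_right.trans (hN.le_of_ge h1 le_sup_left)
  refine ⟨N, ?_, hNp, hmax⟩
  rw [Subgroup.characteristic_iff_map_le]
  intro φ
  refine hmax _ (hNn.map _ φ.surjective) (hNp.of_dvd (Subgroup.card_map_dvd _ _))

theorem lift_normal {G : Type*} [Group G] [Finite G] (π : Set ℕ) (R : Subgroup G) [R.Normal]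
    (A : Subgroup R) (hA : A.Normal) (hA0 : A ≠ ⊥) (hAp : PiSub π A) :
    ∃ B : Subgroup G, B.Normal ∧ B ≠ ⊥ ∧ PiSub π B := by
  obtain ⟨N, hNc, hNp, hmax⟩ := exists_core (G := R) π
  refine ⟨N.map R.subtype, inferInstance, ?_, hNp.of_dvd (Subgroup.card_map_dvd _ _)⟩
  intro h
  rw [Subgroup.map_eq_bot_iff_of_injective _ R.subtype_injective] at h
  exact hA0 (le_bot_iff.1 (h ▸ hmax A hA hAp))

theorem card_conj_eq_index {G : Type*} [Group G] (g : G) :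
    Nat.card (conjugatesOf g) = (Subgroup.centralizer {g}).index := by
  have h1 : conjugatesOf g = MulAction.orbit (ConjAct G) g := by
    ext x
    rw [ConjAct.mem_orbit_conjAct]
    exact isConj_comm
  rw [h1]
  have h2 := MulAction.index_stabilizer (ConjAct G) g
  have h3 := Subgroup.index_comap_of_surjective (MulAction.stabilizer (ConjAct G) g)
    (f := (ConjAct.toConjAct : G ≃* ConjAct G).toMonoidHom) ConjAct.toConjAct.surjective
  rw [Subgroup.centralizer_eq_comap_stabilizer]
  exact (h3.trans h2).symm

theorem burnside_two_primes (n : ℕ) : ∀ (G : Type*) [Group G] [Finite G] [Nontrivial G],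
    Nat.card G = n → ∀ p q : ℕ, p.Prime → q.Prime →
    (∀ r : ℕ, r.Prime → r ∣ Nat.card G → r = p ∨ r = q) →
    ∃ r : ℕ, r.Prime ∧ ∃ B : Subgroup G, B.Normal ∧ B ≠ ⊥ ∧ PiSub {r} B := by
  induction n using Nat.strong_induction_on with
  | _ n ih =>
  intro G _ _ _ hn p q hp hq hpq
  by_cases hM : ∃ M : Subgroup G, M.Normal ∧ M ≠ ⊥ ∧ M ≠ ⊤
  · obtain ⟨M, hMn, hM0, hM1⟩ := hM
    have : Nontrivial M := (Subgroup.nontrivial_iff_ne_bot M).2 hM0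
    have hlt : Nat.card M < n := by
      rw [← hn]
      refine lt_of_le_of_ne (Nat.le_of_dvd Nat.card_pos (Subgroup.card_subgroup_dvd_card M)) ?_
      intro h
      exact hM1 (Subgroup.eq_top_of_card_eq M h)
    obtain ⟨r, hr, A, hA, hA0, hAp⟩ := ih _ hlt M rfl p q hp hq
      fun r hr hd => hpq r hr (hd.trans (Subgroup.card_subgroup_dvd_card M))
    exact ⟨r, hr, lift_normal {r} M A hA hA0 hAp⟩
  by_cases hZ : Subgroup.center G = ⊥
  swap
  · have hZ1 : Nat.card (Subgroup.center G) ≠ 1 := fun h => hZ (Subgroup.card_eq_one.1 h)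
    obtain ⟨r, hr, hrd⟩ := Nat.exists_prime_and_dvd hZ1
    have : Fact r.Prime := ⟨hr⟩
    obtain ⟨x, hx⟩ := exists_prime_orderOf_dvd_card' r hrd
    refine ⟨r, hr, Subgroup.zpowers (x : G), ?_, ?_, ?_⟩
    · constructor
      intro a ha g
      have hc : a ∈ Subgroup.center G := (Subgroup.zpowers_le.2 x.2) ha
      rw [(Subgroup.mem_center_iff.1 hc) g, mul_assoc, mul_inv_cancel, mul_one]
      exact ha
    · rw [Ne, Subgroup.zpowers_eq_bot]
      intro h
      have : x = 1 := Subtype.ext h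
      rw [this, orderOf_one] at hx
      exact hr.one_lt.ne hx
    · intro s hs hd
      rw [Nat.card_zpowers, Subgroup.orderOf_coe, hx] at hd
      exact (Nat.prime_dvd_prime_iff_eq hs hr).1 hd
  exfalso
  have : IsSimpleGroup G := ⟨fun H hH => by
    by_contra! h
    exact hM ⟨H, hH, h.1, h.2⟩⟩
  have hG1 : Nat.card G ≠ 1 := Finite.one_lt_card.ne'
  obtain ⟨r, hr, hrd⟩ := Nat.exists_prime_and_dvd hG1
  have : Fact r.Prime := ⟨hr⟩
  obtain ⟨s, hs, hrs⟩ : ∃ s : ℕ, s.Prime ∧ ∀ t : ℕ, t.Prime → t ∣ Nat.card G → t ≠ r → t = s := by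
    rcases hpq r hr hrd with rfl | rfl
    · exact ⟨q, hq, fun t ht hd hne => (hpq t ht hd).resolve_left hne⟩
    · exact ⟨p, hp, fun t ht hd hne => (hpq t ht hd).resolve_right hne⟩
  obtain ⟨P⟩ : Nonempty (Sylow r G) := inferInstance
  have hP0 : (P : Subgroup G) ≠ ⊥ := P.ne_bot_of_dvd_card hrd
  have : Nontrivial P := (Subgroup.nontrivial_iff_ne_bot _).2 hP0
  have := P.isPGroup'.center_nontrivial
  obtain ⟨z, hz⟩ := exists_ne (1 : Subgroup.center P)
  let g : G := ((z : P) : G)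
  have hg : g ∉ Subgroup.center G := by
    rw [hZ, Subgroup.mem_bot]
    intro h
    exact hz (Subtype.ext (Subtype.ext h))
  have hPc : (P : Subgroup G) ≤ Subgroup.centralizer {g} := by
    intro x hx
    rw [Subgroup.mem_centralizer_singleton_iff]
    have := Subgroup.mem_center_iff.1 z.2 ⟨x, hx⟩
    exact congrArg Subtype.val this
  have hrn : ¬ r ∣ (Subgroup.centralizer {g}).index := fun h =>
    P.not_dvd_index (h.trans (Subgroup.index_dvd_of_le hPc))
  have hpow := Nat.eq_prime_pow_of_unique_prime_dvd (n := (Subgroup.centralizer {g}).index) (p := s)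
    Subgroup.index_ne_zero_of_finite (fun {t} ht hd => hrs t ht
      (hd.trans (Subgroup.index_dvd_card _)) (fun h => hrn (h ▸ hd)))
  exact burnside_class g hg s hs _ ((card_conj_eq_index g).trans hpow)

theorem relIndex_dvd_of_normal_right {G : Type*} [Group G] [Finite G] (H N : Subgroup G)
    [N.Normal] : H.relIndex N ∣ H.index := by
  have h1 : (H ⊓ N).relIndex H * H.relIndex (H ⊔ N) = (H ⊓ N).relIndex N * N.relIndex (H ⊔ N) := by
    rw [Subgroup.relIndex_mul_relIndex _ _ _ inf_le_left le_sup_left,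
      Subgroup.relIndex_mul_relIndex _ _ _ inf_le_right le_sup_right]
  rw [Subgroup.inf_relIndex_left, Subgroup.inf_relIndex_right, Subgroup.relIndex_sup_right,
    mul_comm] at h1
  have h2 : N.relIndex H ≠ 0 := Subgroup.index_ne_zero_of_finite
  have h3 := Nat.eq_of_mul_eq_mul_right (Nat.pos_of_ne_zero h2) h1
  rw [← h3]
  exact Subgroup.relIndex_dvd_index_of_le le_sup_left

theorem relIndex_eq_of_coprime {G : Type*} [Group G] [Finite G] (S T : Subgroup G)
    (h : Nat.Coprime S.index T.index) : S.relIndex T = S.index := by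
  have h1 : S.relIndex T * T.index = T.relIndex S * S.index := by
    rw [← Subgroup.inf_relIndex_right, Subgroup.relIndex_mul_index inf_le_right,
      ← Subgroup.inf_relIndex_left S T, Subgroup.relIndex_mul_index inf_le_left]
  have h2 : S.index ∣ S.relIndex T := h.dvd_of_dvd_mul_right (h1 ▸ dvd_mul_left _ _)
  refine le_antisymm ?_ (Nat.le_of_dvd (Nat.pos_of_ne_zero Subgroup.index_ne_zero_of_finite) h2)
  rw [← Subgroup.relIndex_top_right]
  exact Subgroup.relIndex_le_of_le_right le_top Subgroup.index_ne_zero_of_finite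

theorem exists_mul_of_coprime {G : Type*} [Group G] [Finite G] (S T : Subgroup G)
    (h : Nat.Coprime S.index T.index) (g : G) : ∃ t ∈ T, ∃ s ∈ S, g = t * s := by
  have h1 : (MulAction.stabilizer T ((1 : G) : G ⧸ S)) = S.subgroupOf T := by
    ext t
    rw [MulAction.mem_stabilizer_iff, Subgroup.mem_subgroupOf]
    change (((t : G) * 1 : G) : G ⧸ S) = ((1 : G) : G ⧸ S) ↔ _
    rw [QuotientGroup.eq]
    simp
  have h2 := MulAction.index_stabilizer T ((1 : G) : G ⧸ S)
  rw [h1] at h2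
  have h3 : MulAction.orbit T ((1 : G) : G ⧸ S) = Set.univ := by
    refine Set.eq_of_subset_of_ncard_le (Set.subset_univ _) ?_
    rw [Set.ncard_univ, ← h2]
    exact (relIndex_eq_of_coprime S T h).ge
  have h4 : ((g : G) : G ⧸ S) ∈ MulAction.orbit T ((1 : G) : G ⧸ S) := h3 ▸ Set.mem_univ _
  obtain ⟨t, ht⟩ := h4
  have h5 : (((t : G) * 1 : G) : G ⧸ S) = (g : G ⧸ S) := ht
  rw [QuotientGroup.eq] at h5
  exact ⟨t, t.2, _, h5, by group⟩

section SigmaLemmas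

variable {ι : Type*} {σ : ι → Set ℕ}

theorem SigmaSoluble.map {G H : Type*} [Group G] [Group H] (f : G →* H)
    (hf : Function.Surjective f) (h : SigmaSoluble σ G) : SigmaSoluble σ H := by
  obtain ⟨n, c, h0, h1, hm, hn, hi⟩ := h
  refine ⟨n, fun k => (c k).map f, by simp [h0], ?_, fun a b hab => Subgroup.map_mono (hm hab),
    fun k => (hn k).map f hf, fun k => ?_⟩
  · simp only [h1]; exact Subgroup.map_top_of_surjective f hf
  obtain ⟨i, hi⟩ := hi k
  refine ⟨i, fun p hp hd => hi p hp (hd.trans ?_)⟩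
  have := hn k.castSucc
  change ((c k.castSucc).map f).relIndex ((c k.succ).map f) ∣ (c k.castSucc).relIndex (c k.succ)
  rw [Subgroup.relIndex_map_map]
  have h2 : c k.succ ⊔ f.ker = c k.succ ⊔ (c k.castSucc ⊔ f.ker) := by
    rw [← sup_assoc, sup_eq_left.2 (hm (Fin.castSucc_le_succ k))]
  rw [h2, Subgroup.relIndex_sup_right]
  exact Subgroup.relIndex_dvd_of_le_left _ le_sup_left

theorem SigmaSoluble.subgroup {G : Type*} [Group G] (h : SigmaSoluble σ G) (R : Subgroup G) :
    SigmaSoluble σ R := by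
  obtain ⟨n, c, h0, h1, hm, hn, hi⟩ := h
  refine ⟨n, fun k => (c k).subgroupOf R, by simp [h0], by simp [h1],
    fun a b hab => Subgroup.comap_mono (hm hab), fun k => (hn k).comap _, fun k => ?_⟩
  obtain ⟨i, hi⟩ := hi k
  refine ⟨i, fun p hp hd => hi p hp (hd.trans ?_)⟩
  have := hn k.castSucc
  change ((c k.castSucc).subgroupOf R).relIndex ((c k.succ).subgroupOf R) ∣ _
  rw [Subgroup.subgroupOf, Subgroup.relIndex_comap, Subgroup.subgroupOf_map_subtype,
    ← Subgroup.relIndex_subgroupOf (L := c k.succ) inf_le_left]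
  exact Subgroup.relIndex_dvd_index_of_normal _ _

theorem SigmaSoluble.extend {G : Type*} [Group G] (N : Subgroup G) [N.Normal] (i : ι)
    (hN : PiSub (σ i) N) (h : SigmaSoluble σ (G ⧸ N)) : SigmaSoluble σ G := by
  obtain ⟨n, c, h0, h1, hm, hn, hi⟩ := h
  refine ⟨n + 1, Fin.cons ⊥ fun k => (c k).comap (QuotientGroup.mk' N), rfl, ?_, ?_, ?_, ?_⟩
  · rw [← Fin.succ_last, Fin.cons_succ, h1, Subgroup.comap_top]
  · rw [Fin.monotone_iff_le_succ]
    intro k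
    refine Fin.cases ?_ (fun j => ?_) k
    · exact bot_le
    · rw [← Fin.succ_castSucc, Fin.cons_succ, Fin.cons_succ]
      exact Subgroup.comap_mono (hm (Fin.castSucc_le_succ j))
  · intro k
    refine Fin.cases ?_ (fun j => ?_) k
    · rw [Fin.cons_zero]; infer_instance
    · rw [Fin.cons_succ]; exact (hn j).comap _
  · intro k
    refine Fin.cases ?_ (fun j => ?_) k
    · refine ⟨i, fun p hp hd => hN p hp ?_⟩
      rw [Fin.castSucc_zero, Fin.cons_zero, Fin.cons_succ, h0] at hd
      change p ∣ (⊥ : Subgroup G).relIndex (MonoidHom.ker (QuotientGroup.mk' N)) at hd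
      rwa [QuotientGroup.ker_mk', Subgroup.relIndex_bot_left] at hd
    · obtain ⟨i', hi'⟩ := hi j
      refine ⟨i', fun p hp hd => hi' p hp ?_⟩
      rw [← Fin.succ_castSucc, Fin.cons_succ, Fin.cons_succ] at hd
      change p ∣ (Subgroup.comap _ _).relIndex _ at hd
      rwa [Subgroup.relIndex_comap, Subgroup.map_comap_eq_self_of_surjective
        (QuotientGroup.mk'_surjective N)] at hd

theorem SigmaSoluble.exists_normal {G : Type*} [Group G] [Nontrivial G] (h : SigmaSoluble σ G) :
    ∃ i, ∃ A : Subgroup G, A.Normal ∧ A ≠ ⊥ ∧ PiSub (σ i) A := by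
  obtain ⟨n, c, h0, h1, hm, hn, hi⟩ := h
  by_contra! hcon
  have hall : ∀ k, c k = ⊥ := by
    intro k
    induction k using Fin.induction with
    | zero => exact h0
    | succ k ih =>
      by_contra hne
      obtain ⟨i, hi⟩ := hi k
      refine hcon i (c k.succ) (hn _) hne fun p hp hd => hi p hp ?_
      rw [ih]
      change p ∣ (⊥ : Subgroup G).relIndex _
      rwa [Subgroup.relIndex_bot_left]
  exact bot_ne_top ((hall _).symm.trans h1)

theorem exists_normal_primary (hσ : SigmaPartition σ) {G : Type*} [Group G] [Finite G]
    [Nontrivial G]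
    (H : ∀ p : ℕ, p.Prime → p ∣ Nat.card G →
      ∃ T : Subgroup G, SigmaSoluble σ T ∧ ∃ k, T.index = p ^ k) :
    ∃ i, ∃ A : Subgroup G, A.Normal ∧ A ≠ ⊥ ∧ PiSub (σ i) A := by
  by_contra hcon
  have hclass : ∀ p : ℕ, p.Prime → ∃ i, p ∈ σ i := by
    intro p hp
    have : p ∈ ⋃ i, σ i := by rw [hσ.2.2]; exact hp
    simpa using this
  have huniq : ∀ p i j, p ∈ σ i → p ∈ σ j → i = j := by
    intro p i j hi hj
    by_contra hne
    exact Set.disjoint_left.1 (hσ.2.1 hne) hi hj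
  have htop : ∀ i, ∃ p : ℕ, p.Prime ∧ p ∣ Nat.card G ∧ p ∉ σ i := by
    intro i
    by_contra! h
    refine hcon ⟨i, ⊤, inferInstance, top_ne_bot, fun p hp hd => h p hp ?_⟩
    rwa [Subgroup.card_top] at hd
  -- all primes other than `p` lie in a single class
  have key : ∀ p : ℕ, p.Prime → p ∣ Nat.card G →
      ∃ i, p ∉ σ i ∧ ∀ q : ℕ, q.Prime → q ∣ Nat.card G → q ≠ p → q ∈ σ i := by
    intro p hp hpd
    obtain ⟨T, hT, k, hk⟩ := H p hp hpd
    suffices h : ∃ i, ∀ q : ℕ, q.Prime → q ∣ Nat.card G → q ≠ p → q ∈ σ i by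
      obtain ⟨i, hi⟩ := h
      refine ⟨i, fun hpi => ?_, hi⟩
      obtain ⟨q, hq, hqd, hqi⟩ := htop i
      by_cases hqp : q = p
      · exact hqi (hqp ▸ hpi)
      · exact hqi (hi q hq hqd hqp)
    by_cases hT0 : T = ⊥
    · obtain ⟨i, hi⟩ := hclass p hp
      refine ⟨i, fun q hq hqd hne => ?_⟩
      rw [hT0, Subgroup.index_bot] at hk
      rw [hk] at hqd
      exact absurd ((Nat.prime_dvd_prime_iff_eq hq hp).1 (hq.dvd_of_dvd_pow hqd)) hne
    have : Nontrivial T := (Subgroup.nontrivial_iff_ne_bot T).2 hT0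
    obtain ⟨i, A, hA, hA0, hAp⟩ := hT.exists_normal
    refine ⟨i, fun q hq hqd hne => ?_⟩
    by_contra hqi
    obtain ⟨S, hS, l, hl⟩ := H q hq hqd
    have hcop : Nat.Coprime S.index T.index := by
      rw [hl, hk]
      exact Nat.Coprime.pow _ _ ((Nat.coprime_primes hq hp).2 hne)
    have hAS : A ≤ S.subgroupOf T := by
      rw [← Subgroup.relIndex_eq_one]
      by_contra h1
      obtain ⟨r, hr, hrd⟩ := Nat.exists_prime_and_dvd h1
      have h2 := hAp r hr (hrd.trans (Subgroup.relIndex_dvd_card _ _))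
      have h3 := hrd.trans (relIndex_dvd_of_normal_right (S.subgroupOf T) A)
      have h4 : (S.subgroupOf T).index = q ^ l := (relIndex_eq_of_coprime S T hcop).trans hl
      rw [h4] at h3
      have h5 := (Nat.prime_dvd_prime_iff_eq hr hq).1 (hr.dvd_of_dvd_pow h3)
      exact hqi (h5 ▸ h2)
    let R : Subgroup G := Subgroup.normalClosure (A.map T.subtype : Set G)
    have hRS : R ≤ S := by
      refine (Subgroup.closure_le S).2 ?_
      intro x hx
      obtain ⟨a, ha, hax⟩ := Group.mem_conjugatesOfSet_iff.1 hx
      obtain ⟨g, rfl⟩ := isConj_iff.1 hax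
      obtain ⟨a, ha, rfl⟩ := ha
      obtain ⟨s, hs, t, ht, rfl⟩ := exists_mul_of_coprime T S hcop.symm g
      have h1 : (⟨t, ht⟩ : T) * a * (⟨t, ht⟩ : T)⁻¹ ∈ A := hA.conj_mem a ha ⟨t, ht⟩
      have h2 : t * (a : G) * t⁻¹ ∈ S := hAS h1
      have h3 := S.mul_mem (S.mul_mem hs h2) (S.inv_mem hs)
      have h4 : s * t * (a : G) * (s * t)⁻¹ = s * (t * (a : G) * t⁻¹) * s⁻¹ := by group
      change s * t * (a : G) * (s * t)⁻¹ ∈ S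
      rw [h4]
      exact h3
    have hR0 : R ≠ ⊥ := by
      intro h
      have h1 : A.map T.subtype ≤ R := Subgroup.le_normalClosure
      rw [h, le_bot_iff, Subgroup.map_eq_bot_iff_of_injective _ T.subtype_injective] at h1
      exact hA0 h1
    have hRsol : SigmaSoluble σ R :=
      (hS.subgroup (R.subgroupOf S)).map (Subgroup.subgroupOfEquivOfLe hRS).toMonoidHom
        (Subgroup.subgroupOfEquivOfLe hRS).surjective
    have : Nontrivial R := (Subgroup.nontrivial_iff_ne_bot R).2 hR0
    obtain ⟨j, B, hB, hB0, hBp⟩ := hRsol.exists_normal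
    exact hcon ⟨j, lift_normal (σ j) R B hB hB0 hBp⟩
  have hG1 : Nat.card G ≠ 1 := Finite.one_lt_card.ne'
  obtain ⟨p, hp, hpd⟩ := Nat.exists_prime_and_dvd hG1
  obtain ⟨i, hpi, hi⟩ := key p hp hpd
  -- at most two primes
  obtain ⟨q, hq, hpq⟩ : ∃ q : ℕ, q.Prime ∧
      ∀ r : ℕ, r.Prime → r ∣ Nat.card G → r = p ∨ r = q := by
    by_contra! h
    obtain ⟨q, hq, hqd, hqp, -⟩ := h p hp
    obtain ⟨r, hr, hrd, hrp, hrq⟩ := h q hq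
    obtain ⟨j, hqj, hj⟩ := key q hq hqd
    have hij : i = j := huniq r i j (hi r hr hrd hrp) (hj r hr hrd hrq)
    exact hpi (hij ▸ hj p hp hpd hqp.symm)
  obtain ⟨r, hr, B, hB, hB0, hBp⟩ := burnside_two_primes _ G rfl p q hp hq hpq
  obtain ⟨j, hj⟩ := hclass r hr
  refine hcon ⟨j, B, hB, hB0, fun s hs hd => ?_⟩
  have : s = r := hBp s hs hd
  exact this ▸ hj

theorem sigmaSoluble_of_index (hσ : SigmaPartition σ) (n : ℕ) :
    ∀ (G : Type*) [Group G] [Finite G], Nat.card G = n →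
    (∀ p : ℕ, p.Prime → p ∣ Nat.card G →
      ∃ T : Subgroup G, SigmaSoluble σ T ∧ ∃ k, T.index = p ^ k) → SigmaSoluble σ G := by
  induction n using Nat.strong_induction_on with
  | _ n ih =>
  intro G _ _ hn H
  rcases subsingleton_or_nontrivial G with hG | hG
  · exact ⟨0, fun _ => ⊥, rfl, Subsingleton.elim _ _, fun _ _ _ => le_rfl,
      fun _ => inferInstance, fun k => k.elim0⟩
  obtain ⟨i, A, hA, hA0, hAp⟩ := exists_normal_primary hσ H
  refine SigmaSoluble.extend A i hAp (ih (Nat.card (G ⧸ A)) ?_ (G ⧸ A) rfl ?_)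
  · have h1 := Subgroup.card_eq_card_quotient_mul_card_subgroup A
    have h2 : 1 < Nat.card A := (Subgroup.one_lt_card_iff_ne_bot A).2 hA0
    have h3 : 0 < Nat.card (G ⧸ A) := Nat.card_pos
    nlinarith
  · intro p hp hpd
    obtain ⟨T, hT, k, hk⟩ := H p hp (hpd.trans (Subgroup.card_quotient_dvd_card A))
    refine ⟨T.map (QuotientGroup.mk' A), ?_, ?_⟩
    · exact hT.map ((QuotientGroup.mk' A).subgroupMap T)
        ((QuotientGroup.mk' A).subgroupMap_surjective T)
    · have h1 := Subgroup.index_map_dvd T (QuotientGroup.mk'_surjective A)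
      rw [hk] at h1
      obtain ⟨l, -, hl⟩ := (Nat.dvd_prime_pow hp).1 h1
      exact ⟨l, hl⟩

end SigmaLemmas


/-- **Theorem A(i).** If every maximal subgroup of every Sylow subgroup of a finite
group `G` has a `σ`-soluble supplement in `G`, then `G` is `σ`-soluble. -/
theorem sigma_soluble_of_supplements {ι : Type*} (σ : ι → Set ℕ) (hσ : SigmaPartition σ)
    (G : Type*) [Group G] [Finite G]
    (hsupp : ∀ p : ℕ, p.Prime → p ∣ Nat.card G →
      ∀ (P : Sylow p G) (V : Subgroup G), V < ↑P →
        (∀ W : Subgroup G, V < W → W ≤ ↑P → W = ↑P) →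
        ∃ T : Subgroup G, (V : Set G) * (T : Set G) = Set.univ ∧ SigmaSoluble σ ↥T) :
    SigmaSoluble σ G := by
  refine sigmaSoluble_of_index hσ _ G rfl fun p hp hpd => ?_
  have : Fact p.Prime := ⟨hp⟩
  obtain ⟨P⟩ : Nonempty (Sylow p G) := inferInstance
  have hP0 : (P : Subgroup G) ≠ ⊥ := P.ne_bot_of_dvd_card hpd
  -- a maximal subgroup of `P`
  obtain ⟨V, hV⟩ := (Set.toFinite {V : Subgroup G | V < ↑P}).exists_maximal
    ⟨⊥, bot_lt_iff_ne_bot.2 hP0⟩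
  obtain ⟨T, hVT, hT⟩ := hsupp p hp hpd P V hV.prop (by
    intro W hVW hWP
    by_contra hne
    exact hVW.not_ge (hV.le_of_ge (lt_of_le_of_ne hWP hne) hVW.le))
  refine ⟨T, hT, ?_⟩
  have h1 : (MulAction.stabilizer V ((1 : G) : G ⧸ T)) = T.subgroupOf V := by
    ext t
    rw [MulAction.mem_stabilizer_iff, Subgroup.mem_subgroupOf]
    change (((t : G) * 1 : G) : G ⧸ T) = ((1 : G) : G ⧸ T) ↔ _
    rw [QuotientGroup.eq]
    simp
  have h2 := MulAction.index_stabilizer V ((1 : G) : G ⧸ T)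
  have h3 : MulAction.orbit V ((1 : G) : G ⧸ T) = Set.univ := by
    rw [Set.eq_univ_iff_forall]
    intro x
    obtain ⟨g, rfl⟩ := QuotientGroup.mk_surjective x
    have hg : g ∈ (V : Set G) * (T : Set G) := hVT ▸ Set.mem_univ g
    obtain ⟨v, hv, t, ht, rfl⟩ := hg
    refine ⟨⟨v, hv⟩, ?_⟩
    change ((v * 1 : G) : G ⧸ T) = _
    rw [QuotientGroup.eq]
    simpa using ht
  rw [h1, h3, Set.ncard_univ] at h2
  have h4 : T.index ∣ Nat.card V := by
    change Nat.card (G ⧸ T) ∣ _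
    rw [← h2]
    exact Subgroup.relIndex_dvd_card _ _
  have h5 := h4.trans (Subgroup.card_dvd_of_le hV.prop.le)
  obtain ⟨m, hm⟩ := P.isPGroup'.exists_card_eq
  rw [hm] at h5
  obtain ⟨l, -, hl⟩ := (Nat.dvd_prime_pow hp).1 h5
  exact ⟨l, hl⟩
end

section
/- Let G be a finite group and σ a partition of the set of all primes. Suppose that for every prime p dividing |G|, every Sylow p-subgroup P of G, and every maximal subgroup V of P, there exists a subgroup T of G with VT = G such that T is σ-nilpotent. Then G is σ-nilpotent. -/
open scoped Pointwise

/-- In a `σ`-nilpotent group, elements of prime power order for primes in different classes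
commute. -/
theorem SigmaNilpotent.commute_aux {ι : Type*} (σ : ι → Set ℕ) (hσ : SigmaPartition σ)
    {T : Type*} [Group T] [Finite T] (hT : SigmaNilpotent σ T) {i : ι} {p q : ℕ}
    (hp : p.Prime) (hq : q.Prime) (hpi : p ∈ σ i) (hqi : q ∉ σ i) {x y : T} {a b : ℕ}
    (hx : x ^ p ^ a = 1) (hy : y ^ q ^ b = 1) : Commute x y := by
  obtain ⟨n, H, hn, hind, htop, hprim⟩ := hT
  have hcomm : Pairwise fun i j => ∀ x y : T, x ∈ H i → y ∈ H j → Commute x y := by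
    intro k l hkl x y hx hy
    exact Subgroup.commute_of_normal_of_disjoint _ _ (hn k) (hn l) (hind.pairwiseDisjoint hkl)
      x y hx hy
  have hinj := Subgroup.injective_noncommPiCoprod_of_iSupIndep (hcomm := hcomm) hind
  have hrange := Subgroup.noncommPiCoprod_range (hcomm := hcomm)
  rw [htop] at hrange
  obtain ⟨u, rfl⟩ : x ∈ (Subgroup.noncommPiCoprod hcomm).range := by rw [hrange]; trivial
  obtain ⟨v, rfl⟩ : y ∈ (Subgroup.noncommPiCoprod hcomm).range := by rw [hrange]; trivial
  have triv : ∀ (r c : ℕ) (k : Fin n) (z : H k), r.Prime → z ^ r ^ c = 1 →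
      ¬ r ∣ Nat.card (H k) → z = 1 := by
    intro r c k z hr hz hd
    have h1 : orderOf z ∣ r ^ c := orderOf_dvd_of_pow_eq_one hz
    have h2 : orderOf z ∣ Nat.card (H k) := orderOf_dvd_natCard z
    have h3 : Nat.Coprime (r ^ c) (Nat.card (H k)) :=
      Nat.Coprime.pow_left _ ((Nat.Prime.coprime_iff_not_dvd hr).2 hd)
    exact orderOf_eq_one_iff.1 (Nat.eq_one_of_dvd_coprimes h3 h1 h2)
  have hu : u ^ p ^ a = 1 := hinj (by rw [map_pow, hx, map_one])
  have hv : v ^ q ^ b = 1 := hinj (by rw [map_pow, hy, map_one])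
  have huv : Commute u v := by
    refine Pi.commute_iff.2 fun k => ?_
    obtain ⟨j, hj⟩ := hprim k
    by_cases hpk : p ∣ Nat.card (H k)
    · by_cases hqk : q ∣ Nat.card (H k)
      · exfalso
        have hij : i = j := by
          by_contra hne
          exact Set.disjoint_left.1 (hσ.2.1 hne) hpi (hj p hp hpk)
        subst hij
        exact hqi (hj q hq hqk)
      · rw [triv q b k (v k) hq (congrFun hv k) hqk]
        exact Commute.one_right _
    · rw [triv p a k (u k) hp (congrFun hu k) hpk]
      exact Commute.one_left _
  exact huv.map (Subgroup.noncommPiCoprod hcomm)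

/-- Under the hypothesis of the theorem, elements of prime power order for primes in different
classes commute. -/
theorem commute_of_supplements {ι : Type*} (σ : ι → Set ℕ) (hσ : SigmaPartition σ)
    (G : Type*) [Group G] [Finite G]
    (hsupp : ∀ p : ℕ, p.Prime → p ∣ Nat.card G →
      ∀ (P : Sylow p G) (V : Subgroup G), V < ↑P →
        (∀ W : Subgroup G, V < W → W ≤ ↑P → W = ↑P) →
        ∃ T : Subgroup G, (V : Set G) * (T : Set G) = Set.univ ∧ SigmaNilpotent σ ↥T)
    {i : ι} {p q : ℕ}
    (hp : p.Prime) (hq : q.Prime) (hpi : p ∈ σ i) (hqi : q ∉ σ i) {x y : G} {a b : ℕ}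
    (hx : x ^ p ^ a = 1) (hy : y ^ q ^ b = 1) : Commute x y := by
  have := Fact.mk hp
  have := Fact.mk hq
  have pgrp : ∀ (r c : ℕ) (z : G), r.Prime → z ^ r ^ c = 1 → IsPGroup r (Subgroup.zpowers z) := by
    rintro r c z hr hz ⟨w, m, rfl⟩
    refine ⟨c, Subtype.ext ?_⟩
    change (z ^ m) ^ r ^ c = 1
    rw [← zpow_natCast, ← zpow_mul, mul_comm, zpow_mul, zpow_natCast, hz, one_zpow]
  obtain ⟨P, hP⟩ := (pgrp p a x hp hx).exists_le_sylow
  have hQ := pgrp q b y hq hy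
  set Q := Subgroup.zpowers y with hQdef
  have hxP : x ∈ P := hP (Subgroup.mem_zpowers x)
  suffices h : (P : Subgroup G) ≤ Subgroup.centralizer {y} by
    exact (Subgroup.mem_centralizer_iff.1 (h hxP) y rfl).symm
  by_contra hne
  set C : Subgroup G := P ⊓ Subgroup.centralizer {y} with hC
  have hCP : C < P := lt_of_le_of_ne inf_le_left (fun h => hne (inf_eq_left.1 h))
  obtain ⟨V, hCV, hVmax⟩ := (Set.toFinite {V : Subgroup G | V < P}).exists_le_maximal hCP
  have hVP : V < P := hVmax.1
  have hVm : ∀ W : Subgroup G, V < W → W ≤ ↑P → W = ↑P := by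
    intro W hVW hWP
    by_contra hW
    exact absurd (hVmax.2 (lt_of_le_of_ne hWP hW) hVW.le) (not_le_of_gt hVW)
  have hpG : p ∣ Nat.card G := by
    have h1 : (P : Subgroup G) ≠ ⊥ := fun h => not_lt_bot (h ▸ hVP)
    exact (P.2.card_eq_or_dvd.resolve_left fun h => h1 (Subgroup.card_eq_one.1 h)).trans
      (Subgroup.card_subgroup_dvd_card _)
  obtain ⟨T, hVT, hT⟩ := hsupp p hp hpG P V hVP hVm
  have hVT' : ∀ g : G, ∃ v ∈ V, ∃ t ∈ T, v * t = g := fun g => by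
    have : g ∈ (V : Set G) * (T : Set G) := by rw [hVT]; trivial
    exact this
  -- the index of `T` is a power of `p`
  have hVp : IsPGroup p V := P.2.to_le hVP.le
  obtain ⟨n, hn⟩ := hVp.card_orbit (α := G ⧸ T) ((1 : G) : G ⧸ T)
  have horb : MulAction.orbit V ((1 : G) : G ⧸ T) = Set.univ := by
    refine Set.eq_univ_of_forall fun z => ?_
    induction z using QuotientGroup.induction_on with
    | H g =>
      obtain ⟨v, hv, t, ht, rfl⟩ := hVT' g
      refine ⟨⟨v, hv⟩, ?_⟩
      change ((v * 1 : G) : G ⧸ T) = _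
      rw [QuotientGroup.eq]
      simpa using ht
  rw [horb, Nat.card_univ] at hn
  have hpq : q ≠ p := fun h => hqi (h ▸ hpi)
  have hqd : ¬ q ∣ Nat.card (G ⧸ T) := by
    rw [hn]
    exact fun h => hpq ((Nat.prime_dvd_prime_iff_eq hq hp).1 (hq.dvd_of_dvd_pow h))
  obtain ⟨z, hz⟩ := hQ.nonempty_fixed_point_of_prime_not_dvd_card (G ⧸ T) hqd
  induction z using QuotientGroup.induction_on with
  | H g =>
    obtain ⟨v, hv, t, ht, rfl⟩ := hVT' g
    have h1 : t⁻¹ * (v⁻¹ * y * v) * t ∈ T := by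
      have := hz ⟨y, Subgroup.mem_zpowers y⟩
      change ((y * (v * t) : G) : G ⧸ T) = _ at this
      have := QuotientGroup.eq.1 this.symm
      simpa [mul_assoc] using this
    have h2 : v⁻¹ * y * v ∈ T := by
      have := T.mul_mem (T.mul_mem ht h1) (T.inv_mem ht)
      simpa [mul_assoc] using this
    obtain ⟨x', hx'P, hx'V⟩ := SetLike.exists_of_lt hVP
    obtain ⟨w, hw, s, hs, hws⟩ := hVT' (v⁻¹ * x' * v)
    have hvP := hVP.le hv
    have hwP := hVP.le hw
    have hsP : s ∈ (P : Subgroup G) := by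
      have : s = w⁻¹ * (v⁻¹ * x' * v) := by rw [← hws]; group
      rw [this]
      exact mul_mem (inv_mem hwP) (mul_mem (mul_mem (inv_mem hvP) hx'P) hvP)
    obtain ⟨c, hc⟩ := P.2 ⟨s, hsP⟩
    have hc' : s ^ p ^ c = 1 := congrArg Subtype.val hc
    have hcy : (v⁻¹ * y * v) ^ q ^ b = 1 := by
      have := conj_pow (a := v⁻¹) (b := y) (i := q ^ b)
      rw [inv_inv] at this
      rw [this, hy]; group
    have hcomm : Commute (⟨s, hs⟩ : T) ⟨v⁻¹ * y * v, h2⟩ :=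
      SigmaNilpotent.commute_aux σ hσ hT hp hq hpi hqi
        (a := c) (b := b) (Subtype.ext hc') (Subtype.ext hcy)
    have hcomm' : s * (v⁻¹ * y * v) = (v⁻¹ * y * v) * s := congrArg Subtype.val hcomm
    have hsC : v * s * v⁻¹ ∈ C := by
      refine Subgroup.mem_inf.2 ⟨mul_mem (mul_mem hvP hsP) (inv_mem hvP), ?_⟩
      refine Subgroup.mem_centralizer_iff.2 ?_
      rintro _ rfl
      have := congrArg (fun e => v * e * v⁻¹) hcomm'
      simp only [mul_assoc, mul_inv_cancel, mul_one, mul_inv_cancel_left] at this ⊢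
      exact this.symm
    apply hx'V
    have : x' = v * w * v⁻¹ * (v * s * v⁻¹) := by
      have : x' = v * (v⁻¹ * x' * v) * v⁻¹ := by group
      rw [this, ← hws]; group
    rw [this]
    exact mul_mem (mul_mem (mul_mem hv hw) (inv_mem hv)) (hCV hsC)

/-- A finite group generated by elements of order prime to `q` and having all its `q`-elements
central has order prime to `q`. -/
theorem not_dvd_card_of_central {M : Type*} [Group M] [Finite M] {q : ℕ} (hq : q.Prime)
    (S : Set M) (hS : Subgroup.closure S = ⊤) (hSq : ∀ s ∈ S, ¬ q ∣ orderOf s)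
    (hcen : ∀ (y : M) (b : ℕ), y ^ q ^ b = 1 → ∀ z, Commute y z) : ¬ q ∣ Nat.card M := by
  have := Fact.mk hq
  let P : Sylow q M := default
  have hP : Subgroup.normalizer (P : Set M) ≤ Subgroup.centralizer (P : Set M) := by
    intro z _
    refine Subgroup.mem_centralizer_iff.2 fun y hy => ?_
    obtain ⟨b, hb⟩ := P.2 ⟨y, hy⟩
    exact hcen y b (congrArg Subtype.val hb) z
  have hker : (MonoidHom.transferSylow P hP).ker = ⊤ := by
    rw [eq_top_iff, ← hS, Subgroup.closure_le]
    intro s hs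
    obtain ⟨b, hb⟩ := P.2 (MonoidHom.transferSylow P hP s)
    have h1 := orderOf_dvd_of_pow_eq_one hb
    have h2 := orderOf_map_dvd (MonoidHom.transferSylow P hP) s
    have h3 : Nat.Coprime (q ^ b) (orderOf s) :=
      Nat.Coprime.pow_left _ ((Nat.Prime.coprime_iff_not_dvd hq).2 (hSq s hs))
    exact orderOf_eq_one_iff.1 (Nat.eq_one_of_dvd_coprimes h3 h1 h2)
  have := MonoidHom.not_dvd_card_ker_transferSylow P hP
  rwa [hker, Subgroup.card_top] at this

/-- **Theorem A(ii).** If every maximal subgroup of every Sylow subgroup of a finite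
group `G` has a `σ`-nilpotent supplement in `G`, then `G` is `σ`-nilpotent. -/
theorem sigma_nilpotent_of_supplements {ι : Type*} (σ : ι → Set ℕ) (hσ : SigmaPartition σ)
    (G : Type*) [Group G] [Finite G]
    (hsupp : ∀ p : ℕ, p.Prime → p ∣ Nat.card G →
      ∀ (P : Sylow p G) (V : Subgroup G), V < ↑P →
        (∀ W : Subgroup G, V < W → W ≤ ↑P → W = ↑P) →
        ∃ T : Subgroup G, (V : Set G) * (T : Set G) = Set.univ ∧ SigmaNilpotent σ ↥T) :
    SigmaNilpotent σ G := by
  classical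
  have hcl : ∀ p : ℕ, p.Prime → ∃ i, p ∈ σ i := by
    intro p hp
    have : p ∈ ⋃ i, σ i := by rw [hσ.2.2]; exact hp
    exact Set.mem_iUnion.1 this
  have hpr : ∀ i p, p ∈ σ i → p.Prime := by
    intro i p hp
    have : p ∈ ⋃ i, σ i := Set.mem_iUnion.2 ⟨i, hp⟩
    rw [hσ.2.2] at this
    exact this
  have huniq : ∀ {i j p}, p ∈ σ i → p ∈ σ j → i = j := by
    intro i j p hi hj
    by_contra hne
    exact Set.disjoint_left.1 (hσ.2.1 hne) hi hj
  have hcomm := @commute_of_supplements ι σ hσ G _ _ hsupp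
  let S : ι → Set G := fun i => {x | ∃ p ∈ σ i, ∃ a : ℕ, x ^ p ^ a = 1}
  let M : ι → Subgroup G := fun i => Subgroup.closure (S i)
  have hMn : ∀ i, (M i).Normal := by
    intro i
    have hle : Subgroup.normalClosure (S i) ≤ M i := by
      refine (Subgroup.closure_le _).2 fun x hx => Subgroup.subset_closure ?_
      obtain ⟨s, ⟨p, hp, a, hs⟩, hsx⟩ := Group.mem_conjugatesOfSet_iff.1 hx
      obtain ⟨c, rfl⟩ := isConj_iff.1 hsx
      exact ⟨p, hp, a, by rw [conj_pow, hs]; group⟩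
    have heq : M i = Subgroup.normalClosure (S i) :=
      le_antisymm Subgroup.closure_le_normalClosure hle
    rw [heq]
    infer_instance
  have hyM : ∀ (i : ι) (q : ℕ), q.Prime → q ∉ σ i → ∀ (y : G) (b : ℕ), y ^ q ^ b = 1 →
      ∀ z ∈ M i, Commute y z := by
    intro i q hq hqi y b hy z hz
    have : M i ≤ Subgroup.centralizer {y} := by
      refine (Subgroup.closure_le _).2 ?_
      rintro x ⟨p, hp, a, hx⟩
      refine Subgroup.mem_centralizer_iff.2 ?_
      rintro _ rfl
      exact (hcomm (hpr i p hp) hq hp hqi hx hy).symm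
    exact Subgroup.mem_centralizer_iff.1 (this hz) y rfl
  have hMM : ∀ i j, i ≠ j → ∀ x y : G, x ∈ M i → y ∈ M j → Commute x y := by
    intro i j hij x y hx hy
    have : M j ≤ Subgroup.centralizer {x} := by
      refine (Subgroup.closure_le _).2 ?_
      rintro z ⟨p, hp, a, hz⟩
      refine Subgroup.mem_centralizer_iff.2 ?_
      rintro _ rfl
      exact (hyM i p (hpr j p hp) (fun h => hij (huniq h hp)) z a hz _ hx).symm
    exact Subgroup.mem_centralizer_iff.1 (this hy) x rfl
  have hMcard : ∀ i (q : ℕ), q.Prime → q ∣ Nat.card (M i) → q ∈ σ i := by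
    intro i q hq hqM
    by_contra hqi
    refine not_dvd_card_of_central hq (((↑) : M i → G) ⁻¹' S i)
      (Subgroup.closure_closure_coe_preimage) ?_ ?_ hqM
    · rintro ⟨s, hs⟩ ⟨p, hp, a, hx⟩ hd
      rw [Subgroup.orderOf_mk] at hd
      have h1 := hd.trans (orderOf_dvd_of_pow_eq_one hx)
      have h2 := (Nat.prime_dvd_prime_iff_eq hq (hpr i p hp)).1 (hq.dvd_of_dvd_pow h1)
      exact hqi (h2 ▸ hp)
    · intro y b hy z
      exact Subtype.ext (hyM i q hq hqi y b (congrArg Subtype.val hy) z z.2)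
  have hcl' : ∀ p : (Nat.card G).primeFactors, ∃ i, (p : ℕ) ∈ σ i := fun p =>
    hcl p (Nat.prime_of_mem_primeFactors p.2)
  choose f hf using hcl'
  let F : Finset ι := Finset.univ.image f
  let e := F.equivFin
  let H : Fin F.card → Subgroup G := fun k => M (e.symm k)
  have hinj : ∀ k l, k ≠ l → ((e.symm k : F) : ι) ≠ (e.symm l : F) := by
    intro k l hkl h
    exact hkl (e.symm.injective (Subtype.ext h))
  have hHcomm : Pairwise fun k l => ∀ x y : G, x ∈ H k → y ∈ H l → Commute x y :=
    fun k l hkl => hMM _ _ (hinj k l hkl)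
  refine ⟨F.card, H, fun k => hMn _, ?_, ?_, fun k => ⟨e.symm k, hMcard _⟩⟩
  · have := fun k => Fintype.ofFinite (H k)
    refine Subgroup.independent_of_coprime_order hHcomm fun k l hkl => ?_
    beta_reduce
    rw [← Nat.card_eq_fintype_card, ← Nat.card_eq_fintype_card]
    refine Nat.coprime_of_dvd fun p hp h1 h2 => ?_
    exact hinj k l hkl (huniq (hMcard _ p hp h1) (hMcard _ p hp h2))
  · rw [← Subgroup.index_eq_one]
    by_contra hne
    obtain ⟨p, hp, hpd⟩ := Nat.exists_prime_and_dvd hne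
    have := Fact.mk hp
    have hpG : p ∈ (Nat.card G).primeFactors :=
      Nat.mem_primeFactors.2 ⟨hp, hpd.trans (Subgroup.index_dvd_card _), Nat.card_pos.ne'⟩
    let P : Sylow p G := default
    have hle : (P : Subgroup G) ≤ ⨆ k, H k := by
      have hm : f ⟨p, hpG⟩ ∈ F := Finset.mem_image_of_mem _ (Finset.mem_univ _)
      refine le_trans ?_ (le_iSup H (e ⟨_, hm⟩))
      intro x hx
      obtain ⟨b, hb⟩ := P.2 ⟨x, hx⟩
      change x ∈ M (e.symm (e ⟨_, hm⟩))
      rw [Equiv.symm_apply_apply]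
      exact Subgroup.subset_closure ⟨p, hf ⟨p, hpG⟩, b, congrArg Subtype.val hb⟩
    exact P.not_dvd_index (hpd.trans (Subgroup.index_dvd_of_le hle))
end
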